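/- arXiv:1512.07126 — 2 statements merged into one kernel-verified Lean document; each statement's English description precedes it below -/
import Mathlib

section
/- For all integers n ≥ 1 and k ≥ 0, c(n,k) ≥ α(n,k). -/
open Pointwise

noncomputable section

/-- The set of lattice (integer) points in `ℝ^n`. -/
def lat (n : ℕ) : Set (Fin n → ℝ) := {x | ∀ j, ∃ z : ℤ, x j = (z : ℝ)}

/-- The polyhedron determined by the subsystem of `A x ≤ b` indexed by `I`. -/
def polyI {n m : ℕ} (A : Fin m → Fin n → ℝ) (b : Fin m → ℝ) (I : Set (Fin m)) :
    Set (Fin n → ℝ) := {x | ∀ i ∈ I, ∑ j, A i j * x j ≤ b i}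

/-- The integer points of a set `S ⊆ ℝ^n`. -/
def intPts {n : ℕ} (S : Set (Fin n → ℝ)) : Set (Fin n → ℝ) := S ∩ lat n

/-- `c` is a valid Helly-type bound for dimension `n` and `k` integer points:
any polyhedron with exactly `k` integer points has a subsystem of at most `c`
inequalities with exactly the same integer points. -/
def HellyBound (n k c : ℕ) : Prop :=
  ∀ (m : ℕ) (A : Fin m → Fin n → ℝ) (b : Fin m → ℝ),
    (intPts (polyI A b Set.univ)).Finite →
    (intPts (polyI A b Set.univ)).ncard = k →
    ∃ I : Finset (Fin m), I.card ≤ c ∧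
      intPts (polyI A b (↑I : Set (Fin m))) = intPts (polyI A b Set.univ)

/-- The quantity `c(n,k)`: the least valid Helly-type bound. -/
def cnk (n k : ℕ) : ℕ := sInf {c | HellyBound n k c}

/-- A set of points is in convex position if no point of it lies in the convex
hull of the others. -/
def ConvexPos {n : ℕ} (V : Set (Fin n → ℝ)) : Prop :=
  ∀ v ∈ V, v ∉ convexHull ℝ (V \ {v})

/-- `iconv V = conv(V) ∩ ℤ^n`. -/
def iconv {n : ℕ} (V : Set (Fin n → ℝ)) : Set (Fin n → ℝ) :=
  convexHull ℝ V ∩ lat n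

/-- `ℓ(n,k)`: the smallest integer `s` such that every set `V ⊆ ℤ^n` in convex
position with `|V| = s` satisfies `|iconv(V) \ V| ≥ k`. -/
def ellnk (n k : ℕ) : ℕ :=
  sInf {s | ∀ V : Set (Fin n → ℝ), V ⊆ lat n → ConvexPos V → V.Finite →
    V.ncard = s → k ≤ (iconv V \ V).ncard}

/-- The set of midpoints of `V` that are not in `V`. -/
def midpts {n : ℕ} (V : Set (Fin n → ℝ)) : Set (Fin n → ℝ) :=
  {p | ∃ x ∈ V, ∃ y ∈ V, p = (1/2 : ℝ) • (x + y)} \ V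

/-- `μ_c(n,s)`: the minimum number of midpoints `|M(V)|` over all sets
`V ⊆ ℝ^n` in convex position with `|V| = s`. -/
def muc (n s : ℕ) : ℕ :=
  sInf {m | ∃ V : Set (Fin n → ℝ), ConvexPos V ∧ V.Finite ∧ V.ncard = s ∧
    (midpts V).ncard = m}

/-- `α(n,k)`: the maximum cardinality of a set `V ⊆ ℤ^n` in convex position
with `|iconv(V) \ V| = k`. -/
def alphank (n k : ℕ) : ℕ :=
  sSup {m | ∃ V : Set (Fin n → ℝ), V ⊆ lat n ∧ ConvexPos V ∧ V.Finite ∧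
    V.ncard = m ∧ (iconv V \ V).ncard = k}

/-- A system `A x ≤ b` is non-redundant if removing any single inequality
strictly increases the set of integer points. -/
def NonRedundant {n m : ℕ} (A : Fin m → Fin n → ℝ) (b : Fin m → ℝ) : Prop :=
  ∀ i : Fin m,
    intPts (polyI A b Set.univ) ⊂ intPts (polyI A b ({i}ᶜ : Set (Fin m)))

/-- The set of lattice (integer) points in Euclidean space `ℝ^n`. -/
def latE (n : ℕ) : Set (EuclideanSpace ℝ (Fin n)) := {x | ∀ j, ∃ z : ℤ, x j = (z : ℝ)}


open Classical in
lemma core {α ι : Type*} [Fintype ι] (f : ι → α → ℝ) (Z : Finset α) (S : Set α) (p : ι → α)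
    (hpZ : ∀ i, p i ∈ Z) (hpS : ∀ i, p i ∉ S) (hpj : ∀ i j, j ≠ i → f j (p i) ≤ 0)
    (hZS : ∀ z ∈ Z, (∀ j, f j z ≤ 0) → z ∈ S) :
    ∃ (q : ι → α) (t : ι → ℝ), (∀ i, q i ∈ Z ∧ q i ∉ S ∧ f i (q i) ≤ t i ∧
      ∀ j, j ≠ i → f j (q i) < t j) ∧ ∀ z ∈ Z, (∀ j, f j z < t j) → z ∈ S := by
  let V : Finset ℝ := (Finset.univ ×ˢ Z).image (fun x : ι × α => f x.1 x.2)
  let W : Finset ℝ := insert 1 (V ∪ V.image (· + 1))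
  have hW1 : ∀ i, ∀ z ∈ Z, f i z ∈ W := by
    intro i z hz
    refine Finset.mem_insert_of_mem (Finset.mem_union_left _ ?_)
    exact Finset.mem_image.2 ⟨(i, z), by simp [hz], rfl⟩
  have hW2 : ∀ i, ∀ z ∈ Z, f i z + 1 ∈ W := by
    intro i z hz
    refine Finset.mem_insert_of_mem (Finset.mem_union_right _ ?_)
    exact Finset.mem_image.2 ⟨f i z, Finset.mem_image.2 ⟨(i, z), by simp [hz], rfl⟩, rfl⟩
  let T : Set (ι → ℝ) := {t | (∀ i, t i ∈ W) ∧ (∀ i, 0 < t i) ∧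
    ∀ z ∈ Z, (∀ j, f j z < t j) → z ∈ S}
  have hTfin : T.Finite := by
    refine (Fintype.piFinset (fun _ : ι => W)).finite_toSet.subset ?_
    intro t ht
    simpa using ht.1
  have hTne : T.Nonempty := by
    have hne : (W.filter (0 < ·)).Nonempty := ⟨1, by simp [W]⟩
    obtain ⟨w, hw, hmin⟩ := Finset.exists_min_image _ id hne
    rw [Finset.mem_filter] at hw
    refine ⟨fun _ => w, fun _ => hw.1, fun _ => hw.2, ?_⟩
    intro z hz h
    refine hZS z hz fun j => ?_
    by_contra hc
    have := hmin (f j z) (by simp only [Finset.mem_filter]; exact ⟨hW1 j z hz, not_le.1 hc⟩)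
    exact absurd (h j) (not_lt.2 this)
  obtain ⟨t, ht⟩ := hTfin.exists_maximal hTne
  obtain ⟨⟨htW, htp, hts⟩, hmax⟩ := ht
  have key : ∀ i, ∃ z, z ∈ Z ∧ z ∉ S ∧ f i z ≤ t i ∧ ∀ j, j ≠ i → f j z < t j := by
    intro i
    have hne : (W.filter (t i < ·)).Nonempty := by
      refine ⟨f i (p i) + 1, ?_⟩
      simp only [Finset.mem_filter]
      refine ⟨hW2 i _ (hpZ i), ?_⟩
      by_contra hc
      refine hpS i (hts _ (hpZ i) fun j => ?_)
      by_cases hj : j = i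
      · subst hj; linarith
      · exact (hpj i j hj).trans_lt (htp j)
    obtain ⟨w, hw, hmin⟩ := Finset.exists_min_image _ id hne
    rw [Finset.mem_filter] at hw
    have hnot : Function.update t i w ∉ T := by
      intro hT
      have hle : t ≤ Function.update t i w := by
        intro j
        by_cases hj : j = i
        · subst hj; simpa using hw.2.le
        · simp [hj]
      have := hmax hT hle i
      simp at this
      linarith [hw.2]
    have : ¬ ∀ z ∈ Z, (∀ j, f j z < Function.update t i w j) → z ∈ S := by
      intro h
      refine hnot ⟨fun j => ?_, fun j => ?_, h⟩
      · by_cases hj : j = i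
        · subst hj; simpa using hw.1
        · simpa [hj] using htW j
      · by_cases hj : j = i
        · subst hj; simpa using (htp j).trans hw.2
        · simpa [hj] using htp j
    push Not at this
    obtain ⟨z, hz, hlt, hzS⟩ := this
    refine ⟨z, hz, hzS, ?_, fun j hj => by simpa [hj] using hlt j⟩
    by_contra hc
    have h1 := hmin (f i z) (by simp only [Finset.mem_filter]; exact ⟨hW1 i z hz, not_le.1 hc⟩)
    have h2 := hlt i
    simp at h1 h2
    linarith
  choose q hq using key
  exact ⟨q, t, hq, hts⟩

lemma parity_count {n : ℕ} {ι : Type*} [Fintype ι] (f : ι → (Fin n → ℤ) → ℝ)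
    (hf : ∀ i x y m, x + y = m + m → f i x + f i y = f i m + f i m)
    (N : ℤ) (S : Finset (Fin n → ℤ)) (p : ι → Fin n → ℤ)
    (hpZ : ∀ i, p i ∈ Finset.Icc (fun _ => -N) (fun _ => N))
    (hpS : ∀ i, p i ∉ S) (hpj : ∀ i j, j ≠ i → f j (p i) ≤ 0)
    (hZS : ∀ z, (∀ j, f j z ≤ 0) → z ∈ S) : Fintype.card ι ≤ 2 ^ n * (S.card + 1) := by
  classical
  obtain ⟨q, t, hq, hts⟩ := core f (Finset.Icc (fun _ => -N) (fun _ => N)) (S : Set (Fin n → ℤ)) p hpZ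
    (by simpa using hpS) hpj (fun z _ h => by simpa using hZS z h)
  by_contra hc
  obtain ⟨c, hc⟩ := Fintype.exists_lt_card_fiber_of_mul_lt_card
    (fun i => (fun j => ((q i j : ℤ) : ZMod 2) : Fin n → ZMod 2)) (n := S.card + 1) (by
      simpa [ZMod.card] using hc)
  set F := Finset.univ.filter (fun i => (fun j => ((q i j : ℤ) : ZMod 2)) = c) with hF
  have hFne : F.Nonempty := Finset.card_pos.1 (by omega)
  obtain ⟨i0, hi0⟩ := hFne
  have hmem : ∀ i ∈ F.erase i0, ∃ m, q i0 + q i = m + m ∧ m ∈ S := by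
    intro i hi
    obtain ⟨hne, hi⟩ := Finset.mem_erase.1 hi
    have h1 := (Finset.mem_filter.1 hi0).2
    have h2 := (Finset.mem_filter.1 hi).2
    have h3 : ∀ j, ∃ m, q i0 j + q i j = m + m := by
      intro j
      have h4 : ((q i0 j : ℤ) : ZMod 2) = ((q i j : ℤ) : ZMod 2) := by
        rw [congrFun h1 j, congrFun h2 j]
      rw [ZMod.intCast_eq_intCast_iff] at h4
      have : q i0 j % 2 = q i j % 2 := h4
      exact ⟨(q i0 j + q i j) / 2, by omega⟩
    choose m hm using h3
    have hm' : q i0 + q i = m + m := funext hm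
    refine ⟨m, hm', ?_⟩
    have := hts m ?_ ?_
    · simpa using this
    · have ha := Finset.mem_Icc.1 (hq i0).1
      have hb := Finset.mem_Icc.1 (hq i).1
      refine Finset.mem_Icc.2 ⟨fun j => ?_, fun j => ?_⟩
      · have := ha.1 j; have := hb.1 j; have := hm j; simp only at *; omega
      · have := ha.2 j; have := hb.2 j; have := hm j; simp only at *; omega
    · intro j
      have h := hf j _ _ _ hm'
      by_cases hj : j = i0
      · subst hj
        have := (hq j).2.2.1
        have := (hq i).2.2.2 j hne.symm
        linarith
      · have h5 := (hq i0).2.2.2 j hj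
        by_cases hj' : j = i
        · subst hj'
          have := (hq j).2.2.1
          linarith
        · have := (hq i).2.2.2 j hj'
          linarith
  choose! g hg hgS using hmem
  have hinj : Set.InjOn g (F.erase i0) := by
    intro i hi j hj hij
    have e1 := hg i hi
    have e2 := hg j hj
    rw [hij, ← e2] at e1
    have e3 : q i = q j := add_left_cancel e1
    by_contra hne
    refine (hq i).2.1 (hts _ (hq i).1 fun l => ?_)
    by_cases hl : l = i
    · rw [e3]; exact (hq j).2.2.2 l (by rw [hl]; exact hne)
    · exact (hq i).2.2.2 l hl
  have := Finset.card_le_card_of_injOn g hgS hinj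
  rw [Finset.card_erase_of_mem hi0] at this
  omega

def emb {n : ℕ} (z : Fin n → ℤ) : Fin n → ℝ := fun j => (z j : ℝ)

lemma emb_inj {n : ℕ} : Function.Injective (emb (n := n)) := by
  intro x y h
  funext j
  have := congrFun h j
  simpa [emb] using this

lemma emb_mem {n : ℕ} (z : Fin n → ℤ) : emb z ∈ lat n := fun j => ⟨z j, rfl⟩

lemma exists_emb {n : ℕ} {x : Fin n → ℝ} (hx : x ∈ lat n) : ∃ z, emb z = x := by
  choose z hz using hx
  exact ⟨z, funext fun j => (hz j).symm⟩

lemma box_finite (n : ℕ) (N : ℤ) :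
    {x | x ∈ lat n ∧ ∀ j, x j ≤ (N : ℝ) ∧ -x j ≤ (N : ℝ)}.Finite := by
  refine ((Finset.Icc (fun _ : Fin n => -N) (fun _ => N)).finite_toSet.image emb).subset ?_
  rintro x ⟨hx, hb⟩
  obtain ⟨z, rfl⟩ := exists_emb hx
  refine ⟨z, ?_, rfl⟩
  simp only [Finset.coe_Icc, Set.mem_Icc, Pi.le_def]
  refine ⟨fun j => ?_, fun j => ?_⟩
  · have := (hb j).2
    simp only [emb] at this
    have h : -(z j) ≤ N := by exact_mod_cast this
    omega
  · have := (hb j).1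
    simp only [emb] at this
    exact_mod_cast this

lemma helly_exists (n k : ℕ) : HellyBound n k (2 ^ n * (k + 1)) := by
  classical
  intro m A b hfin hk
  set S := intPts (polyI A b Set.univ) with hS
  have hne : ((Finset.univ : Finset (Finset (Fin m))).filter
      (fun I : Finset (Fin m) => intPts (polyI A b (↑I : Set (Fin m))) = S)).Nonempty :=
    ⟨Finset.univ, by simp [hS]⟩
  obtain ⟨I, hI, hmin⟩ := Finset.exists_min_image _ Finset.card hne
  have hI := (Finset.mem_filter.1 hI).2
  refine ⟨I, ?_, hI⟩
  have hp : ∀ i : I, ∃ z : Fin n → ℤ, emb z ∉ S ∧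
      ∀ j : I, j ≠ i → ∑ l, A j l * emb z l ≤ b j := by
    intro i
    by_contra hcon
    push Not at hcon
    have h1 := hmin (I.erase i) (by
      simp only [Finset.mem_filter, Finset.mem_univ, true_and]
      apply Set.Subset.antisymm
      · rintro x ⟨hx, hl⟩
        obtain ⟨z, rfl⟩ := exists_emb hl
        by_contra hz
        obtain ⟨j, hj, hlt⟩ := hcon z hz
        have := hx j (by simpa using fun h => hj (Subtype.ext h))
        linarith
      · rw [hS]
        rintro x ⟨hx, hl⟩
        exact ⟨fun j _ => hx j trivial, hl⟩)
    rw [Finset.card_erase_of_mem i.2] at h1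
    have := Finset.card_pos.2 ⟨_, i.2⟩
    omega
  choose p hpS hpj using hp
  have hS'fin : (emb ⁻¹' S).Finite := hfin.preimage emb_inj.injOn
  have hN : ∃ N : ℤ, ∀ i, p i ∈ Finset.Icc (fun _ => -N) (fun _ => N) := by
    refine ⟨∑ i, ∑ j, |p i j|, fun i => ?_⟩
    have h : ∀ j, |p i j| ≤ ∑ i, ∑ j, |p i j| := fun j =>
      (Finset.single_le_sum (f := fun j => |p i j|) (fun _ _ => abs_nonneg _)
        (Finset.mem_univ j)).trans
      (Finset.single_le_sum (f := fun i => ∑ j, |p i j|)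
        (fun _ _ => Finset.sum_nonneg fun _ _ => abs_nonneg _) (Finset.mem_univ i))
    exact Finset.mem_Icc.2 ⟨fun j => (abs_le.1 (h j)).1, fun j => (abs_le.1 (h j)).2⟩
  obtain ⟨N, hN⟩ := hN
  have := parity_count (ι := I) (fun i z => ∑ l, A i l * emb z l - b i) ?_ N hS'fin.toFinset p hN
    (by simpa using hpS) (fun i j hj => by have := hpj i j hj; linarith) ?_
  · rw [Fintype.card_coe] at this
    refine this.trans (Nat.mul_le_mul_left _ (Nat.add_le_add_right ?_ 1))
    rw [← hk, Set.ncard_eq_toFinset_card _ hfin]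
    refine Finset.card_le_card_of_injOn emb ?_ emb_inj.injOn
    intro x hx
    simpa using hx
  · intro i x y w h
    have : ∑ l, A i l * emb x l + ∑ l, A i l * emb y l
        = ∑ l, A i l * emb w l + ∑ l, A i l * emb w l := by
      rw [← Finset.sum_add_distrib, ← Finset.sum_add_distrib]
      refine Finset.sum_congr rfl fun l _ => ?_
      have h2 : (x l : ℝ) + y l = w l + w l := by exact_mod_cast congrFun h l
      simp only [emb]
      rw [← mul_add, ← mul_add, h2]
    linarith
  · intro z hz
    simp only [Set.Finite.mem_toFinset, Set.mem_preimage]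
    rw [← hI]
    exact ⟨fun i hi => by have := hz ⟨i, hi⟩; simp only at this; linarith, emb_mem z⟩

lemma helly_fintype {n k c : ℕ} (h : HellyBound n k c) {ι : Type} [Fintype ι]
    (A : ι → Fin n → ℝ) (b : ι → ℝ) (S : Set (Fin n → ℝ))
    (hS : ∀ x, x ∈ S ↔ (∀ i, ∑ j, A i j * x j ≤ b i) ∧ x ∈ lat n)
    (hfin : S.Finite) (hk : S.ncard = k) :
    ∃ I : Finset ι, I.card ≤ c ∧
      ∀ x ∈ lat n, (∀ i ∈ I, ∑ j, A i j * x j ≤ b i) → x ∈ S := by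
  classical
  let e := Fintype.equivFin ι
  have hEq : intPts (polyI (A ∘ e.symm) (b ∘ e.symm) Set.univ) = S := by
    ext x
    rw [hS]
    constructor
    · rintro ⟨hx, hl⟩
      exact ⟨fun i => by simpa using hx (e i) trivial, hl⟩
    · rintro ⟨hx, hl⟩
      exact ⟨fun i _ => hx _, hl⟩
  obtain ⟨I, hc, hI⟩ := h _ (A ∘ e.symm) (b ∘ e.symm) (by rwa [hEq]) (by rwa [hEq])
  refine ⟨I.map e.symm.toEmbedding, by simpa using hc, fun x hl hx => ?_⟩
  rw [← hEq, ← hI]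
  exact ⟨fun i hi => hx _ (by simpa using hi), hl⟩

lemma sep_dot {n : ℕ} {V : Set (Fin n → ℝ)} (hV : V.Finite) {v : Fin n → ℝ}
    (hv : v ∉ convexHull ℝ V) : ∃ (a : Fin n → ℝ) (u : ℝ),
      (∀ x ∈ convexHull ℝ V, ∑ j, a j * x j ≤ u) ∧ u < ∑ j, a j * v j := by
  classical
  obtain ⟨f, u, h1, h2⟩ := geometric_hahn_banach_closed_point (convex_convexHull ℝ V)
    (hV.isClosed_convexHull ℝ) hv
  have hf : ∀ x, f x = ∑ j, f (Pi.single j 1) * x j := by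
    intro x
    have := LinearMap.pi_apply_eq_sum_univ (f : (Fin n → ℝ) →ₗ[ℝ] ℝ) x
    simp only [ContinuousLinearMap.coe_coe, smul_eq_mul] at this
    rw [this]
    refine Finset.sum_congr rfl fun j _ => ?_
    rw [mul_comm]
    congr 2
    funext i
    simp [Pi.single_apply, eq_comm]
  exact ⟨fun j => f (Pi.single j 1), u, fun x hx => by rw [← hf]; exact (h1 x hx).le,
    by rw [← hf]; exact h2⟩

lemma sep_vertex {n : ℕ} {V : Set (Fin n → ℝ)} (hV : V.Finite) (hc : ConvexPos V)
    (hfin : (iconv V).Finite) {v : Fin n → ℝ} (hv : v ∈ V) :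
    ∃ (a : Fin n → ℝ) (u : ℝ),
      (∀ x ∈ iconv V, x ≠ v → ∑ j, a j * x j ≤ u) ∧ u < ∑ j, a j * v j := by
  classical
  obtain ⟨a, u, h1, h2⟩ := sep_dot (hV.subset Set.sdiff_subset) (hc v hv)
  have hcv : Convex ℝ {x : Fin n → ℝ | x = v ∨ ∑ j, a j * x j < ∑ j, a j * v j} := by
    rw [convex_iff_forall_pos]
    intro x hx y hy s t hs ht hst
    have hlin : ∑ j, a j * (s • x + t • y) j
        = s * ∑ j, a j * x j + t * ∑ j, a j * y j := by
      rw [Finset.mul_sum, Finset.mul_sum, ← Finset.sum_add_distrib]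
      refine Finset.sum_congr rfl fun j _ => ?_
      simp only [Pi.add_apply, Pi.smul_apply, smul_eq_mul]; ring
    by_cases hxy : x = v ∧ y = v
    · left
      rw [hxy.1, hxy.2, ← add_smul, hst, one_smul]
    · right
      rw [hlin]
      have hs' : s = 1 - t := by linarith
      rcases hx with rfl | hx <;> rcases hy with rfl | hy
      · exact absurd ⟨rfl, rfl⟩ hxy
      · subst hs'; nlinarith
      · subst hs'; nlinarith
      · subst hs'; nlinarith
  have hsub : convexHull ℝ V ⊆ {x : Fin n → ℝ | x = v ∨ ∑ j, a j * x j < ∑ j, a j * v j} := by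
    refine convexHull_min (fun x hx => ?_) hcv
    by_cases hxv : x = v
    · exact Or.inl hxv
    · exact Or.inr ((h1 x (subset_convexHull ℝ _ ⟨hx, hxv⟩)).trans_lt h2)
  by_cases hne : (hfin.toFinset.erase v).Nonempty
  · obtain ⟨y, hy, hmax⟩ := Finset.exists_max_image _ (fun x => ∑ j, a j * x j) hne
    refine ⟨a, ∑ j, a j * y j, fun x hx hxv => hmax x (by simp [hx, hxv]), ?_⟩
    simp only [Finset.mem_erase, Set.Finite.mem_toFinset] at hy
    exact (hsub hy.2.1).resolve_left hy.1
  · refine ⟨a, u, fun x hx hxv => ?_, h2⟩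
    exact absurd ⟨x, by simp [hx, hxv]⟩ hne

lemma alpha_le {n k c : ℕ} (h : HellyBound n k c) {V : Set (Fin n → ℝ)} (hl : V ⊆ lat n)
    (hc : ConvexPos V) (hV : V.Finite) (hk : (iconv V \ V).ncard = k) : V.ncard ≤ c := by
  classical
  obtain ⟨C, hC⟩ := (hV.isCompact_convexHull ℝ).isBounded.exists_norm_le
  have hbox : ∀ x ∈ convexHull ℝ V, ∀ j, x j ≤ ((⌈C⌉ : ℤ) : ℝ) ∧ -x j ≤ ((⌈C⌉ : ℤ) : ℝ) := by
    intro x hx j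
    have h1 := (norm_le_pi_norm x j).trans ((hC x hx).trans (Int.le_ceil C))
    rw [Real.norm_eq_abs] at h1
    exact ⟨(le_abs_self _).trans h1, (neg_le_abs _).trans h1⟩
  have hbf := box_finite n ⌈C⌉
  have hfin : (iconv V).Finite := hbf.subset fun x hx => ⟨hx.2, hbox x hx.1⟩
  let B : Set (Fin n → ℝ) := {x | x ∈ lat n ∧ ∀ j, x j ≤ ((⌈C⌉ : ℤ) : ℝ) ∧ -x j ≤ ((⌈C⌉ : ℤ) : ℝ)}
    \ convexHull ℝ V
  have hB : B.Finite := hbf.subset Set.sdiff_subset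
  letI : Fintype V := hV.fintype
  letI : Fintype B := hB.fintype
  have sv := fun v : V => sep_vertex hV hc hfin v.2
  have sb := fun v : B => sep_dot hV v.2.2
  choose a u hau hau' using sv
  choose a' u' hb hb' using sb
  have hsub : ∀ v ∈ V, v ∈ iconv V := fun v hv => ⟨subset_convexHull ℝ _ hv, hl hv⟩
  let A : V ⊕ (B ⊕ (Fin n ⊕ Fin n)) → Fin n → ℝ := Sum.elim a (Sum.elim a'
    (Sum.elim (fun i => Pi.single i 1) (fun i => Pi.single i (-1))))
  let b : V ⊕ (B ⊕ (Fin n ⊕ Fin n)) → ℝ := Sum.elim u (Sum.elim u'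
    (Sum.elim (fun _ => ((⌈C⌉ : ℤ) : ℝ)) (fun _ => ((⌈C⌉ : ℤ) : ℝ))))
  have hP : ∀ x ∈ convexHull ℝ V, ∀ i, ∑ j, A (Sum.inr i) j * x j ≤ b (Sum.inr i) := by
    intro x hx i
    rcases i with i | i | i
    · exact hb i x hx
    · simpa [A, b, Pi.single_apply] using (hbox x hx i).1
    · simpa [A, b, Pi.single_apply] using (hbox x hx i).2
  obtain ⟨I, hIc, hI⟩ := helly_fintype h A b (iconv V \ V) (by
    intro x
    constructor
    · rintro ⟨hx, hxV⟩
      refine ⟨?_, hx.2⟩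
      rintro (i | i)
      · exact hau i x hx (fun e => hxV (e ▸ i.2))
      · exact hP x hx.1 i
    · rintro ⟨hx, hxl⟩
      have hxV : x ∉ V := fun hv => absurd (hx (Sum.inl ⟨x, hv⟩)) (not_le.2 (hau' ⟨x, hv⟩))
      refine ⟨⟨?_, hxl⟩, hxV⟩
      by_contra hxc
      have hxB : x ∈ B := by
        refine ⟨⟨hxl, fun j => ⟨?_, ?_⟩⟩, hxc⟩
        · simpa [A, b, Pi.single_apply] using hx (Sum.inr (Sum.inr (Sum.inl j)))
        · simpa [A, b, Pi.single_apply] using hx (Sum.inr (Sum.inr (Sum.inr j)))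
      exact absurd (hx (Sum.inr (Sum.inl ⟨x, hxB⟩))) (not_le.2 (hb' ⟨x, hxB⟩)))
    (hfin.subset Set.sdiff_subset) hk
  have hall : ∀ v : V, Sum.inl v ∈ I := by
    intro v
    by_contra hvI
    refine (hI v (hl v.2) ?_).2 v.2
    rintro (i | i) hi
    · exact hau i v (hsub v v.2) (fun e => hvI (by rwa [Subtype.ext e]))
    · exact hP v (hsub v v.2).1 i
  refine le_trans ?_ hIc
  rw [← Nat.card_coe_set_eq, Nat.card_eq_fintype_card, ← Finset.card_univ]
  exact Finset.card_le_card_of_injOn Sum.inl (fun v _ => hall v) Sum.inl_injective.injOn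

/-- `c(n,k) ≥ α(n,k)`. -/
theorem stmt12 (n k : ℕ) (hn : 1 ≤ n) : alphank n k ≤ cnk n k := by
  have hc : HellyBound n k (cnk n k) :=
    Nat.sInf_mem (s := {c | HellyBound n k c}) ⟨_, helly_exists n k⟩
  refine csSup_le' ?_
  rintro m ⟨V, hl, hpos, hV, rfl, hk⟩
  exact alpha_le hc hl hpos hV hk
end
end

section
/- For every integer n ≥ 1, c(n,2) = 2(2^n − 1). -/
open Pointwise

noncomputable section

lemma relax {X ι : Type*} [DecidableEq ι] (S : Finset X) (I : Finset ι) (a : ι → X → ℝ) (b : ι → ℝ)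
    (v : ι → X) (hvS : ∀ i ∈ I, v i ∈ S) (hv : ∀ i ∈ I, b i < a i (v i))
    (hv' : ∀ i ∈ I, ∀ j ∈ I, j ≠ i → a j (v i) ≤ b j) (J : Finset ι) (hJ : J ⊆ I) :
    ∃ w : ι → X, (∀ i ∈ J, w i ∈ S ∧ b i < a i (w i) ∧
        (∀ j ∈ J, j ≠ i → a j (w i) < a j (w j)) ∧ (∀ j ∈ I, j ∉ J → a j (w i) ≤ b j)) ∧
      (∀ z ∈ S, (∀ j ∈ J, a j z < a j (w j)) → (∀ j ∈ I, j ∉ J → a j z ≤ b j) →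
        ∀ j ∈ I, a j z ≤ b j) := by
  classical
  induction J using Finset.induction_on with
  | empty =>
    refine ⟨v, by simp, ?_⟩
    intro z hz _ h j hj
    exact h j hj (by simp)
  | insert i J hi ih =>
    obtain ⟨w, hw, hF⟩ := ih (fun x hx => hJ (Finset.mem_insert_of_mem hx))
    have hiI : i ∈ I := hJ (Finset.mem_insert_self _ _)
    let C := S.filter (fun z => (∀ j ∈ J, a j z < a j (w j)) ∧
      (∀ j ∈ I, j ∉ insert i J → a j z ≤ b j) ∧ b i < a i z)
    have hC : C.Nonempty := by
      refine ⟨v i, ?_⟩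
      simp only [C, Finset.mem_filter]
      refine ⟨hvS i hiI, ?_, ?_, hv i hiI⟩
      · intro j hj
        have hji : j ≠ i := by rintro rfl; exact hi hj
        exact lt_of_le_of_lt (hv' i hiI j (hJ (Finset.mem_insert_of_mem hj)) hji) (hw j hj).2.1
      · intro j hj hjn
        exact hv' i hiI j hj (fun h => hjn (h ▸ Finset.mem_insert_self _ _))
    obtain ⟨c, hcC, hcmin⟩ := Finset.exists_min_image C (a i) hC
    have hc := hcC
    simp only [C, Finset.mem_filter] at hc
    obtain ⟨hcS, hc1, hc2, hc3⟩ := hc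
    have hupd : ∀ j ∈ J, Function.update w i c j = w j := fun j hj =>
      Function.update_of_ne (by rintro rfl; exact hi hj) _ _
    refine ⟨Function.update w i c, ?_, ?_⟩
    · intro k hk
      rcases Finset.mem_insert.1 hk with rfl | hkJ
      · rw [Function.update_self]
        refine ⟨hcS, hc3, ?_, hc2⟩
        intro j hj hjk
        have hjJ : j ∈ J := (Finset.mem_insert.1 hj).resolve_left hjk
        rw [hupd j hjJ]
        exact hc1 j hjJ
      · rw [hupd k hkJ]
        obtain ⟨h1, h2, h3, h4⟩ := hw k hkJ
        refine ⟨h1, h2, ?_, ?_⟩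
        · intro j hj hjk
          rcases Finset.mem_insert.1 hj with rfl | hjJ
          · rw [Function.update_self]
            exact lt_of_le_of_lt (h4 j hiI hi) hc3
          · rw [hupd j hjJ]
            exact h3 j hjJ hjk
        · intro j hj hjn
          exact h4 j hj (fun h => hjn (Finset.mem_insert_of_mem h))
    · intro z hz h1 h2
      have h1' : ∀ j ∈ J, a j z < a j (w j) := by
        intro j hj
        have := h1 j (Finset.mem_insert_of_mem hj)
        rwa [hupd j hj] at this
      have hlt := h1 i (Finset.mem_insert_self _ _)
      rw [Function.update_self] at hlt
      have hib : a i z ≤ b i := by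
        by_contra hcon
        push Not at hcon
        have := hcmin z (by
          simp only [C, Finset.mem_filter]
          exact ⟨hz, h1', h2, hcon⟩)
        linarith
      refine hF z hz h1' ?_
      intro j hj hjJ
      by_cases hji : j = i
      · subst hji; exact hib
      · exact h2 j hj (by simp [hji, hjJ])

lemma exists_mid {n : ℕ} (x y : Fin n → ℤ)
    (h : (fun j => (x j : ZMod 2)) = fun j => (y j : ZMod 2)) : ∃ z, x + y = z + z := by
  have h2 : ∀ j, ∃ z, x j + y j = z + z := by
    intro j
    have := congrFun h j
    rw [ZMod.intCast_eq_intCast_iff_dvd_sub] at this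
    obtain ⟨k, hk⟩ := this
    exact ⟨x j + k, by push_cast at hk; omega⟩
  choose z hz using h2
  exact ⟨z, funext hz⟩

lemma upper_core {n : ℕ} {ι : Type*} [DecidableEq ι] (I : Finset ι) (a : ι → (Fin n → ℤ) → ℝ)
    (b : ι → ℝ) (hmid : ∀ i x y z, x + y = z + z → a i x + a i y = 2 * a i z)
    (p q : Fin n → ℤ) (hpq : p ≠ q)
    (hfeas : ∀ z, (∀ i ∈ I, a i z ≤ b i) ↔ z = p ∨ z = q)
    (hv : ∀ i ∈ I, ∃ v, b i < a i v ∧ ∀ j ∈ I, j ≠ i → a j v ≤ b j) :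
    I.card ≤ 2 * (2 ^ n - 1) := by
  classical
  have hv2 : ∀ i, ∃ v, i ∈ I → b i < a i v ∧ ∀ j ∈ I, j ≠ i → a j v ≤ b j := by
    intro i
    by_cases h : i ∈ I
    · obtain ⟨v, hv⟩ := hv i h
      exact ⟨v, fun _ => hv⟩
    · exact ⟨0, fun h' => absurd h' h⟩
  choose v hv3 using hv2
  let T : Finset (Fin n → ℤ) := insert p (insert q (I.image v))
  obtain ⟨u, hu⟩ := T.finite_toSet.bddAbove
  obtain ⟨l, hl⟩ := T.finite_toSet.bddBelow
  let S := Finset.Icc l u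
  have hTS : ∀ x ∈ T, x ∈ S := fun x hx => Finset.mem_Icc.2 ⟨hl hx, hu hx⟩
  have hSmid : ∀ x y z, x ∈ S → y ∈ S → x + y = z + z → z ∈ S := by
    intro x y z hx hy h
    simp only [S, Finset.mem_Icc, Pi.le_def] at hx hy ⊢
    constructor <;> intro j <;>
    · have h1 := congrFun h j
      simp only [Pi.add_apply] at h1
      have := hx.1 j; have := hx.2 j; have := hy.1 j; have := hy.2 j
      omega
  obtain ⟨w, hw, hF⟩ := relax S I a b v
    (fun i hi => hTS _ (by simp only [T, Finset.mem_insert, Finset.mem_image]; exact Or.inr (Or.inr ⟨i, hi, rfl⟩)))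
    (fun i hi => (hv3 i hi).1) (fun i hi => (hv3 i hi).2) I subset_rfl
  have hF' : ∀ z ∈ S, (∀ j ∈ I, a j z < a j (w j)) → z = p ∨ z = q := fun z hz h =>
    (hfeas z).1 (hF z hz h (fun j hj hn => absurd hj hn))
  have hpf := (hfeas p).2 (Or.inl rfl)
  have hqf := (hfeas q).2 (Or.inr rfl)
  have hpS : p ∈ S := hTS p (by simp [T])
  have hqS : q ∈ S := hTS q (by simp [T])
  -- midpoints of a feasible point with w i
  have hmw : ∀ f ∈ S, (∀ i ∈ I, a i f ≤ b i) → ∀ i ∈ I, ∀ z, f + w i = z + z → z = p ∨ z = q := by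
    intro f hfS hf i hi z hz
    refine hF' z (hSmid _ _ _ hfS (hw i hi).1 hz) ?_
    intro j hj
    have h1 := hmid j _ _ _ hz
    have h2 := hf j hj
    have h3 := (hw j hj).2.1
    have h4 : a j (w i) ≤ a j (w j) := by
      by_cases hji : j = i
      · rw [hji]
      · exact ((hw i hi).2.2.1 j hj hji).le
    linarith
  have hww : ∀ i ∈ I, ∀ k ∈ I, i ≠ k → ∀ z, w i + w k = z + z → z = p ∨ z = q := by
    intro i hi k hk hik z hz
    refine hF' z (hSmid _ _ _ (hw i hi).1 (hw k hk).1 hz) ?_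
    intro j hj
    have h1 := hmid j _ _ _ hz
    by_cases hji : j = i
    · subst hji
      have := (hw k hk).2.2.1 j hj hik
      linarith
    · have h2 := (hw i hi).2.2.1 j hj hji
      have h4 : a j (w k) ≤ a j (w j) := by
        by_cases hji : j = k
        · rw [hji]
        · exact ((hw k hk).2.2.1 j hj hji).le
      linarith
  have hinj : ∀ i ∈ I, ∀ k ∈ I, w i = w k → i = k := by
    intro i hi k hk h
    by_contra hne
    have := (hw i hi).2.2.1 k hk (Ne.symm hne)
    rw [h] at this
    exact lt_irrefl _ this
  have hnotf : ∀ i ∈ I, w i ≠ p ∧ w i ≠ q := by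
    intro i hi
    have := (hw i hi).2.1
    constructor <;> intro h <;> rw [h] at this
    · linarith [hpf i hi]
    · linarith [hqf i hi]
  let cl : (Fin n → ℤ) → (Fin n → ZMod 2) := fun x j => (x j : ZMod 2)
  have hcpq : cl p ≠ cl q := by
    intro h
    obtain ⟨z, hz⟩ := exists_mid p q h
    have : z = p ∨ z = q := (hfeas z).1 (by
      intro i hi
      have h1 := hmid i _ _ _ hz
      linarith [hpf i hi, hqf i hi])
    rcases this with rfl | rfl
    · exact hpq (add_left_cancel hz).symm
    · exact hpq (add_right_cancel hz)
  have hfib : ∀ c ∈ (Finset.univ : Finset (Fin n → ZMod 2)),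
      (I.filter (fun i => cl (w i) = c)).card ≤ if c = cl p ∨ c = cl q then 1 else 2 := by
    intro c _
    split_ifs with hc
    · rw [Finset.card_le_one]
      intro i hi k hk
      simp only [Finset.mem_filter] at hi hk
      rcases hc with rfl | rfl
      · have key : ∀ i ∈ I, cl (w i) = cl p → p + w i = q + q := by
          intro i' hi' h
          obtain ⟨z, hz⟩ := exists_mid p (w i') h.symm
          rcases hmw p hpS hpf i' hi' z hz with rfl | rfl
          · exact absurd (add_left_cancel hz) (hnotf i' hi').1
          · exact hz
        exact hinj i hi.1 k hk.1 (add_left_cancel ((key i hi.1 hi.2).trans (key k hk.1 hk.2).symm))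
      · have key : ∀ i ∈ I, cl (w i) = cl q → q + w i = p + p := by
          intro i' hi' h
          obtain ⟨z, hz⟩ := exists_mid q (w i') h.symm
          rcases hmw q hqS hqf i' hi' z hz with rfl | rfl
          · exact hz
          · exact absurd (add_left_cancel hz) (hnotf i' hi').2
        exact hinj i hi.1 k hk.1 (add_left_cancel ((key i hi.1 hi.2).trans (key k hk.1 hk.2).symm))
    · by_contra hcard
      push Not at hcard
      obtain ⟨i, j, k, hi, hj, hk, hij, hik, hjk⟩ := Finset.two_lt_card_iff.1 hcard
      simp only [Finset.mem_filter] at hi hj hk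
      obtain ⟨x, hx⟩ := exists_mid (w i) (w j) (hi.2.trans hj.2.symm)
      obtain ⟨y, hy⟩ := exists_mid (w i) (w k) (hi.2.trans hk.2.symm)
      obtain ⟨z, hz⟩ := exists_mid (w j) (w k) (hj.2.trans hk.2.symm)
      have hxy : x ≠ y := by
        rintro rfl
        exact hjk (hinj _ hj.1 _ hk.1 (add_left_cancel (hx.trans hy.symm)))
      have hxz : x ≠ z := by
        rintro rfl
        rw [add_comm] at hx
        exact hik (hinj _ hi.1 _ hk.1 (add_left_cancel (hx.trans hz.symm)))
      have hyz : y ≠ z := by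
        rintro rfl
        exact hij (hinj _ hi.1 _ hj.1 (add_right_cancel (hy.trans hz.symm)))
      have h1 := hww i hi.1 j hj.1 hij x hx
      have h2 := hww i hi.1 k hk.1 hik y hy
      have h3 := hww j hj.1 k hk.1 hjk z hz
      rcases h1 with h1 | h1 <;> rcases h2 with h2 | h2 <;> rcases h3 with h3 | h3 <;> subst_vars <;>
        simp_all
  have h1 := Finset.card_eq_sum_card_fiberwise (s := I) (f := fun i => cl (w i)) (t := Finset.univ)
    (by intro i hi; simp)
  have h2 := Finset.sum_le_sum hfib
  have h3 : ∑ c : Fin n → ZMod 2, (if c = cl p ∨ c = cl q then 1 else 2) + 2 = 2 * 2 ^ n := by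
    have e : ∀ c : Fin n → ZMod 2, (if c = cl p ∨ c = cl q then 1 else 2) +
        ((if c = cl p then 1 else 0) + (if c = cl q then 1 else 0)) = 2 := by
      intro c
      by_cases hp : c = cl p <;> by_cases hq : c = cl q <;> simp [hp, hq]
      · exact absurd (hp.symm.trans hq) hcpq
      · simp [hcpq]
      · simp [hcpq.symm]
    have := Finset.sum_congr rfl (fun c (_ : c ∈ (Finset.univ : Finset (Fin n → ZMod 2))) => e c)
    rw [Finset.sum_add_distrib, Finset.sum_add_distrib] at this
    simp only [Finset.sum_ite_eq', Finset.mem_univ, if_true, Finset.sum_const, Finset.card_univ,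
      Fintype.card_fun, ZMod.card, Fintype.card_fin, smul_eq_mul] at this
    omega
  omega

lemma upper (n : ℕ) : HellyBound n 2 (2 * (2 ^ n - 1)) := by
  classical
  intro m A b _ hcard
  let P : Finset (Fin m) → Prop := fun I =>
    intPts (polyI A b (↑I : Set (Fin m))) = intPts (polyI A b Set.univ)
  have hne : (Finset.univ.filter P).Nonempty := ⟨Finset.univ, by simp [P]⟩
  obtain ⟨I, hI, hmin⟩ := Finset.exists_min_image _ Finset.card hne
  have hPI : P I := by simpa using hI
  refine ⟨I, ?_, hPI⟩
  let ι : (Fin n → ℤ) → (Fin n → ℝ) := fun z j => (z j : ℝ)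
  have hιinj : Function.Injective ι := by
    intro x y h
    funext j
    have : (x j : ℝ) = (y j : ℝ) := congrFun h j
    exact_mod_cast this
  have hlat : ∀ x ∈ lat n, ∃ z, ι z = x := by
    intro x hx
    choose z hz using hx
    exact ⟨z, funext fun j => (hz j).symm⟩
  have hιlat : ∀ z, ι z ∈ lat n := fun z j => ⟨z j, rfl⟩
  obtain ⟨p', q', hpq', hset⟩ := Set.ncard_eq_two.1 hcard
  obtain ⟨p, rfl⟩ := hlat p' ((hset ▸ (by simp) : p' ∈ intPts (polyI A b Set.univ))).2
  obtain ⟨q, rfl⟩ := hlat q' ((hset ▸ (by simp) : q' ∈ intPts (polyI A b Set.univ))).2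
  refine upper_core I (fun i z => ∑ j, A i j * (z j : ℝ)) b ?_ p q (fun h => hpq' (by rw [h])) ?_ ?_
  · intro i x y z h
    rw [Finset.mul_sum, ← Finset.sum_add_distrib]
    refine Finset.sum_congr rfl fun j _ => ?_
    have h1 := congrFun h j
    simp only [Pi.add_apply] at h1
    have h2 : (x j : ℝ) + y j = z j + z j := by exact_mod_cast h1
    linear_combination A i j * h2
  · intro z
    have h1 : (∀ i ∈ I, ∑ j, A i j * (z j : ℝ) ≤ b i) ↔ ι z ∈ intPts (polyI A b (↑I : Set (Fin m))) :=
      ⟨fun h => ⟨fun i hi => h i hi, hιlat z⟩, fun h i hi => h.1 i hi⟩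
    rw [h1, hPI, hset]
    simp [hιinj.eq_iff]
  · intro i hi
    have hnP : ¬ P (I.erase i) := by
      intro h
      have := hmin (I.erase i) (by simpa using h)
      have := Finset.card_erase_lt_of_mem hi
      omega
    have hsub : intPts (polyI A b Set.univ) ⊆ intPts (polyI A b (↑(I.erase i) : Set (Fin m))) :=
      fun x hx => ⟨fun k _ => hx.1 k (Set.mem_univ _), hx.2⟩
    have : ∃ x ∈ intPts (polyI A b (↑(I.erase i) : Set (Fin m))), x ∉ intPts (polyI A b Set.univ) := by
      by_contra hcon
      push Not at hcon
      exact hnP (Set.Subset.antisymm hcon hsub)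
    obtain ⟨x, hx, hxn⟩ := this
    obtain ⟨z, rfl⟩ := hlat x hx.2
    have hothers : ∀ j ∈ I, j ≠ i → ∑ k, A j k * (z k : ℝ) ≤ b j := fun j hj hji =>
      hx.1 j (by simp [hj, hji])
    refine ⟨z, ?_, hothers⟩
    by_contra hle
    push Not at hle
    apply hxn
    rw [← hPI]
    refine ⟨fun j hj => ?_, hx.2⟩
    by_cases hji : j = i
    · subst hji; exact hle
    · exact hothers j hj hji

lemma lower_core {n c : ℕ} {ι W : Type} [Fintype ι] [Fintype W] (A : ι → Fin n → ℝ) (b : ι → ℝ)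
    (w : W → Fin n → ℝ) (g : W → ι) (hg : Function.Injective g) (hw : ∀ t, w t ∈ lat n)
    (h1 : ∀ t i, i ≠ g t → ∑ j, A i j * w t j ≤ b i)
    (h2 : ∀ t, b (g t) < ∑ j, A (g t) j * w t j)
    (p q : Fin n → ℝ) (hpq : p ≠ q)
    (hf : ∀ x ∈ lat n, (∀ i, ∑ j, A i j * x j ≤ b i) → x = p ∨ x = q)
    (hp : p ∈ lat n) (hq : q ∈ lat n) (hpf : ∀ i, ∑ j, A i j * p j ≤ b i)
    (hqf : ∀ i, ∑ j, A i j * q j ≤ b i)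
    (hH : HellyBound n 2 c) : Fintype.card W ≤ c := by
  classical
  let e := Fintype.equivFin ι
  have hset : intPts (polyI (fun i => A (e.symm i)) (fun i => b (e.symm i)) Set.univ) = {p, q} := by
    ext x
    constructor
    · rintro ⟨hx, hxl⟩
      refine hf x hxl fun i => ?_
      have := hx (e i) (Set.mem_univ _)
      simpa using this
    · rintro (rfl | rfl)
      · exact ⟨fun i _ => hpf _, hp⟩
      · exact ⟨fun i _ => hqf _, hq⟩
  obtain ⟨I, hIc, hI⟩ := hH _ (fun i => A (e.symm i)) (fun i => b (e.symm i))
    (by rw [hset]; simp) (by rw [hset]; exact Set.ncard_pair hpq)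
  have hmem : ∀ t, e (g t) ∈ I := by
    intro t
    by_contra hn
    have : w t ∈ intPts (polyI (fun i => A (e.symm i)) (fun i => b (e.symm i)) (↑I : Set (Fin _))) := by
      refine ⟨fun i hi => h1 t _ ?_, hw t⟩
      rintro h
      apply hn
      rw [← h]
      simpa using hi
    rw [hI] at this
    have := this.1 (e (g t)) (Set.mem_univ _)
    simp only [Equiv.symm_apply_apply] at this
    linarith [h2 t]
  calc Fintype.card W = (Finset.univ.image (fun t => e (g t))).card := by
        exact (Finset.card_image_of_injective _ (e.injective.comp hg)).symm
    _ ≤ I.card := Finset.card_le_card (by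
        intro i hi
        simp only [Finset.mem_image, Finset.mem_univ, true_and] at hi
        obtain ⟨t, rfl⟩ := hi
        exact hmem t)
    _ ≤ c := hIc

/-- sign of a Boolean -/
def sg (s : Bool) : ℝ := if s then 1 else -1
/-- zero-one value of a Boolean -/
def bv (s : Bool) : ℝ := if s then 1 else 0
/-- indicator vector -/
def chi {m : ℕ} (v : Finset (Fin m)) (j : Fin m) : ℝ := if j ∈ v then 1 else 0
/-- coefficients of the functional exposing the indicator vector of `u` -/
def coef {m : ℕ} (u : Finset (Fin m)) (j : Fin m) : ℝ := if j ∈ u then (m : ℝ) + 1 else -1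

/-- index type of the excluded points -/
abbrev WI (m : ℕ) : Type := ({u : Finset (Fin m) // u.Nonempty} × Bool × Bool) ⊕ Bool
/-- index type of the outer constraints -/
abbrev OI (m : ℕ) : Type := (Bool × Fin m) ⊕ (Bool × Fin m) ⊕ (Fin m × Fin m)

/-- the excluded points -/
def wpt {m : ℕ} : WI m → Fin (m + 1) → ℝ
  | Sum.inl (u, t, e) => Fin.cons (bv e) (fun j => sg t * chi u.1 j)
  | Sum.inr s => Fin.cons (if s then 2 else -1) (fun _ => 0)

/-- the constraint matrix -/
def AA {m : ℕ} : WI m ⊕ OI m → Fin (m + 1) → ℝ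
  | Sum.inl (Sum.inl (u, t, e)) => Fin.cons (sg e) (fun j => 4 * sg t * coef u.1 j)
  | Sum.inl (Sum.inr s) => Fin.cons (sg s) (fun _ => 0)
  | Sum.inr (Sum.inl (s, i)) => Fin.cons 1 (fun j => if j = i then sg s else 0)
  | Sum.inr (Sum.inr (Sum.inl (s, i))) => Fin.cons (-1) (fun j => if j = i then sg s else 0)
  | Sum.inr (Sum.inr (Sum.inr (i, k))) =>
      Fin.cons 0 (fun j => (if j = i then 1 else 0) - (if j = k then 1 else 0))

/-- the right-hand side -/
def BB {m : ℕ} : WI m ⊕ OI m → ℝ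
  | Sum.inl (Sum.inl (u, _, e)) => 4 * (∑ j, coef u.1 j * chi u.1 j) + bv e - 1
  | Sum.inl (Sum.inr s) => bv s
  | Sum.inr (Sum.inl _) => 2
  | Sum.inr (Sum.inr (Sum.inl _)) => 1
  | Sum.inr (Sum.inr (Sum.inr _)) => 1

/-- evaluation of the constraints -/
def LL {m : ℕ} (x0 : ℝ) (y : Fin m → ℝ) : WI m ⊕ OI m → ℝ
  | Sum.inl (Sum.inl (u, t, e)) => sg e * x0 + 4 * (∑ j, coef u.1 j * (sg t * y j))
  | Sum.inl (Sum.inr s) => sg s * x0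
  | Sum.inr (Sum.inl (s, i)) => x0 + sg s * y i
  | Sum.inr (Sum.inr (Sum.inl (s, i))) => -x0 + sg s * y i
  | Sum.inr (Sum.inr (Sum.inr (i, k))) => y i - y k

lemma sum_AA {m : ℕ} (i : WI m ⊕ OI m) (x : Fin (m + 1) → ℝ) :
    ∑ j, AA i j * x j = LL (x 0) (fun j => x j.succ) i := by
  rw [Fin.sum_univ_succ]
  rcases i with (⟨u, t, e⟩ | s) | (⟨s, i⟩ | ⟨s, i⟩ | ⟨i, k⟩)
  · simp only [AA, LL, Fin.cons_zero, Fin.cons_succ, Finset.mul_sum]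
    congr 1
    refine Finset.sum_congr rfl fun j _ => by ring
  · simp [AA, LL]
  · simp [AA, LL]
  · simp [AA, LL]
  · simp [AA, LL, sub_mul, Finset.sum_sub_distrib]

lemma fu_pos {m : ℕ} (u v : Finset (Fin m)) (h : v ≠ u) :
    ∑ j, coef u j * chi v j ≤ ∑ j, coef u j * chi u j - 1 := by
  have hm : (0 : ℝ) ≤ m := Nat.cast_nonneg m
  have h0 : ∀ j, 0 ≤ coef u j * chi u j - coef u j * chi v j := by
    intro j
    unfold coef chi
    by_cases h1 : j ∈ u <;> by_cases h2 : j ∈ v <;> simp [h1, h2]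
    linarith
  have h1 : ∃ j, 1 ≤ coef u j * chi u j - coef u j * chi v j := by
    have : ∃ j, ¬ (j ∈ v ↔ j ∈ u) := by
      by_contra hc
      push Not at hc
      exact h (Finset.ext hc)
    obtain ⟨j, hj⟩ := this
    refine ⟨j, ?_⟩
    unfold coef chi
    by_cases h1 : j ∈ u <;> by_cases h2 : j ∈ v <;> simp_all
  obtain ⟨j, hj⟩ := h1
  have := Finset.single_le_sum (f := fun j => coef u j * chi u j - coef u j * chi v j)
    (fun j _ => h0 j) (Finset.mem_univ j)
  rw [Finset.sum_sub_distrib] at this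
  linarith

lemma fu_neg {m : ℕ} (u v : Finset (Fin m)) (h : u.Nonempty) :
    ∑ j, coef u j * (-chi v j) ≤ ∑ j, coef u j * chi u j - 1 := by
  have hm : (0 : ℝ) ≤ m := Nat.cast_nonneg m
  obtain ⟨i, hi⟩ := h
  have h0 : ∀ j, 0 ≤ coef u j * chi u j := by
    intro j
    unfold coef chi
    by_cases h1 : j ∈ u <;> simp [h1]
    linarith
  have h1 := Finset.single_le_sum (f := fun j => coef u j * chi u j)
    (fun j _ => h0 j) (Finset.mem_univ i)
  have h2 : coef u i * chi u i = m + 1 := by simp [coef, chi, hi]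
  have h3 : ∑ j, coef u j * (-chi v j) ≤ ∑ j : Fin m, (1 : ℝ) := by
    refine Finset.sum_le_sum fun j _ => ?_
    unfold coef chi
    by_cases h1 : j ∈ u <;> by_cases h2 : j ∈ v <;> simp [h1, h2]
    linarith
  simp only [Finset.sum_const, Finset.card_univ, Fintype.card_fin, nsmul_eq_mul, mul_one] at h3
  simp only [h2] at h1
  linarith

lemma fu_one {m : ℕ} (u : Finset (Fin m)) (h : u.Nonempty) : 1 ≤ ∑ j, coef u j * chi u j := by
  have := fu_neg u ∅ h
  simp [chi] at this
  simpa [chi] using this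

lemma fu_sg {m : ℕ} (u v : Finset (Fin m)) (h : u.Nonempty) (t r : Bool) (hne : ¬ (v = u ∧ r = t)) :
    ∑ j, coef u j * (sg t * (sg r * chi v j)) ≤ ∑ j, coef u j * chi u j - 1 := by
  have hn := fu_neg u v h
  by_cases hv : v = u
  · cases t <;> cases r <;> simp_all [sg]
  · have hp := fu_pos u v hv
    cases t <;> cases r <;> simp_all [sg]

lemma fu_self {m : ℕ} (u : Finset (Fin m)) (t : Bool) :
    ∑ j, coef u j * (sg t * (sg t * chi u j)) = ∑ j, coef u j * chi u j := by
  cases t <;> simp [sg]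

lemma wpt_viol {m : ℕ} (t : WI m) : BB (Sum.inl t) < ∑ j, AA (Sum.inl t) j * wpt t j := by
  rw [sum_AA]
  rcases t with ⟨u, t, e⟩ | s
  · simp only [BB, LL, wpt, Fin.cons_zero, Fin.cons_succ]
    rw [fu_self]
    cases e <;> simp [sg, bv]
  · cases s <;> simp [BB, LL, wpt, sg, bv]

lemma chi_abs {m : ℕ} (v : Finset (Fin m)) (j : Fin m) : 0 ≤ chi v j ∧ chi v j ≤ 1 := by
  unfold chi; split_ifs <;> norm_num

lemma wpt_sat {m : ℕ} (t : WI m) (i : WI m ⊕ OI m) (hi : i ≠ Sum.inl t) :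
    ∑ j, AA i j * wpt t j ≤ BB i := by
  rw [sum_AA]
  rcases t with ⟨v, r, d⟩ | q
  · rcases i with (⟨u, t, e⟩ | s) | (⟨s, i⟩ | ⟨s, i⟩ | ⟨i, k⟩) <;>
      simp only [BB, LL, wpt, Fin.cons_zero, Fin.cons_succ]
    · by_cases h : v.1 = u.1 ∧ r = t
      · obtain ⟨h1, rfl⟩ := h
        have h1 : v = u := Subtype.ext h1
        subst h1
        rw [fu_self]
        have hed : e ≠ d := fun h => hi (by rw [h])
        cases e <;> cases d <;> simp_all [sg, bv]
      · have := fu_sg u.1 v.1 u.2 t r h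
        have : sg e * bv d ≤ bv e + 1 := by cases e <;> cases d <;> norm_num [sg, bv]
        linarith
    · cases s <;> cases d <;> norm_num [sg, bv]
    · have := chi_abs v.1 i
      cases s <;> cases d <;> cases r <;> norm_num [sg, bv] <;> linarith
    · have := chi_abs v.1 i
      cases s <;> cases d <;> cases r <;> norm_num [sg, bv] <;> linarith
    · have := chi_abs v.1 i
      have := chi_abs v.1 k
      cases r <;> norm_num [sg, bv] <;> linarith
  · rcases i with (⟨u, t, e⟩ | s) | (⟨s, i⟩ | ⟨s, i⟩ | ⟨i, k⟩) <;>
      simp only [BB, LL, wpt, Fin.cons_zero, Fin.cons_succ]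
    · have := fu_one u.1 u.2
      simp only [mul_zero, Finset.sum_const_zero]
      cases e <;> cases q <;> norm_num [sg, bv] <;> linarith
    · cases s <;> cases q <;> simp_all [sg, bv]
    · cases q <;> norm_num
    · cases q <;> norm_num
    · norm_num

lemma wpt_lat {m : ℕ} (t : WI m) : wpt t ∈ lat (m + 1) := by
  intro j
  rcases t with ⟨v, r, d⟩ | q
  · refine Fin.cases ?_ (fun j => ?_) j
    · cases d
      · exact ⟨0, by simp [wpt, bv]⟩
      · exact ⟨1, by simp [wpt, bv]⟩
    · by_cases h : j ∈ v.1
      · cases r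
        · exact ⟨-1, by simp [wpt, sg, chi, h]⟩
        · exact ⟨1, by simp [wpt, sg, chi, h]⟩
      · exact ⟨0, by simp [wpt, chi, h]⟩
  · refine Fin.cases ?_ (fun j => ?_) j
    · cases q
      · exact ⟨-1, by simp [wpt]⟩
      · exact ⟨2, by simp [wpt]⟩
    · exact ⟨0, by simp [wpt]⟩

/-- the feasible points -/
def fpt (m : ℕ) (e : Bool) : Fin (m + 1) → ℝ := Fin.cons (bv e) (fun _ => 0)

lemma fpt_lat (m : ℕ) (e : Bool) : fpt m e ∈ lat (m + 1) := by
  intro j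
  refine Fin.cases ?_ (fun j => ?_) j
  · cases e
    · exact ⟨0, by simp [fpt, bv]⟩
    · exact ⟨1, by simp [fpt, bv]⟩
  · exact ⟨0, by simp [fpt]⟩

lemma fpt_sat {m : ℕ} (d : Bool) (i : WI m ⊕ OI m) : ∑ j, AA i j * fpt m d j ≤ BB i := by
  rw [sum_AA]
  rcases i with (⟨u, t, e⟩ | s) | (⟨s, i⟩ | ⟨s, i⟩ | ⟨i, k⟩) <;>
    simp only [BB, LL, fpt, Fin.cons_zero, Fin.cons_succ]
  · have := fu_one u.1 u.2
    simp only [mul_zero, Finset.sum_const_zero]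
    cases e <;> cases d <;> norm_num [sg, bv] <;> linarith
  · cases s <;> cases d <;> norm_num [sg, bv]
  · cases d <;> norm_num [bv]
  · cases d <;> norm_num [bv]
  · norm_num

lemma feas {m : ℕ} (x : Fin (m + 1) → ℝ) (hx : x ∈ lat (m + 1))
    (h : ∀ i : WI m ⊕ OI m, ∑ j, AA i j * x j ≤ BB i) : x = fpt m false ∨ x = fpt m true := by
  classical
  choose z hz using hx
  have h' := h
  simp only [sum_AA] at h'
  have a1 : 0 ≤ z 0 := by
    have := h' (Sum.inl (Sum.inr false))
    simp only [LL, BB, sg, bv, hz] at this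
    norm_num at this
    exact this
  have a2 : z 0 ≤ 1 := by
    have := h' (Sum.inl (Sum.inr true))
    simp only [LL, BB, sg, bv, hz] at this
    norm_num at this
    exact_mod_cast this
  have a3 : ∀ i : Fin m, z 0 + z i.succ ≤ 2 := by
    intro i
    have := h' (Sum.inr (Sum.inl (true, i)))
    simp only [LL, BB, sg, hz] at this
    norm_num at this
    exact_mod_cast this
  have a4 : ∀ i : Fin m, z 0 - z i.succ ≤ 2 := by
    intro i
    have := h' (Sum.inr (Sum.inl (false, i)))
    simp only [LL, BB, sg, hz] at this
    norm_num at this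
    have h2 : (z 0 : ℝ) - z i.succ ≤ 2 := by linarith
    exact_mod_cast h2
  have a5 : ∀ i : Fin m, - z 0 + z i.succ ≤ 1 := by
    intro i
    have := h' (Sum.inr (Sum.inr (Sum.inl (true, i))))
    simp only [LL, BB, sg, hz, if_true, one_mul] at this
    exact_mod_cast this
  have a6 : ∀ i : Fin m, - z 0 - z i.succ ≤ 1 := by
    intro i
    have := h' (Sum.inr (Sum.inr (Sum.inl (false, i))))
    simp only [LL, BB, sg, hz] at this
    norm_num at this
    have h2 : -(z 0 : ℝ) - z i.succ ≤ 1 := by linarith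
    exact_mod_cast h2
  have a7 : ∀ i k : Fin m, z i.succ - z k.succ ≤ 1 := by
    intro i k
    have := h' (Sum.inr (Sum.inr (Sum.inr (i, k))))
    simp only [LL, BB, hz] at this
    exact_mod_cast this
  obtain ⟨e, he⟩ : ∃ e : Bool, x 0 = bv e := by
    rcases (by omega : z 0 = 0 ∨ z 0 = 1) with h0 | h0
    · exact ⟨false, by simp [hz, h0, bv]⟩
    · exact ⟨true, by simp [hz, h0, bv]⟩
  let v : Finset (Fin m) := Finset.univ.filter (fun i => z i.succ ≠ 0)
  by_cases hv : v.Nonempty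
  · exfalso
    obtain ⟨r, hr⟩ : ∃ r : Bool, ∀ i : Fin m, x i.succ = sg r * chi v i := by
      by_cases hall : ∀ i : Fin m, 0 ≤ z i.succ
      · refine ⟨true, fun i => ?_⟩
        have := a3 i; have := a5 i; have := hall i
        rcases (by omega : z i.succ = 0 ∨ z i.succ = 1) with h0 | h0
        · simp [hz, h0, chi, v]
        · simp [hz, h0, chi, v, sg]
      · push Not at hall
        obtain ⟨k, hk⟩ := hall
        refine ⟨false, fun i => ?_⟩
        have := a4 i; have := a6 i; have := a7 i k
        rcases (by omega : z i.succ = 0 ∨ z i.succ = -1) with h0 | h0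
        · simp [hz, h0, chi, v]
        · simp [hz, h0, chi, v, sg]
    have hxw : x = wpt (Sum.inl (⟨v, hv⟩, r, e)) := by
      funext j
      refine Fin.cases ?_ (fun j => ?_) j
      · simp [wpt, he]
      · simp [wpt, hr]
    have h1 := wpt_viol (m := m) (Sum.inl (⟨v, hv⟩, r, e))
    rw [← hxw] at h1
    exact absurd (h _) (not_le.2 h1)
  · have hx : x = fpt m e := by
      funext j
      refine Fin.cases ?_ (fun j => ?_) j
      · simp [fpt, he]
      · have : j ∉ v := fun hj => hv ⟨j, hj⟩
        simp [v] at this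
        simp [fpt, hz, this]
    cases e
    · exact Or.inl hx
    · exact Or.inr hx

lemma card_WI (m : ℕ) : Fintype.card (WI m) = 2 * (2 ^ (m + 1) - 1) := by
  have h1 : Fintype.card {u : Finset (Fin m) // u.Nonempty} = 2 ^ m - 1 := by
    have := Fintype.card_subtype_compl (fun u : Finset (Fin m) => u = ∅)
    simp only [Fintype.card_finset, Fintype.card_fin, Fintype.card_subtype_eq] at this
    rw [← this]
    exact Fintype.card_congr (Equiv.subtypeEquivRight fun u => Finset.nonempty_iff_ne_empty)
  simp only [WI, Fintype.card_sum, Fintype.card_prod, Fintype.card_bool, h1]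
  have : 1 ≤ 2 ^ m := Nat.one_le_two_pow
  rw [pow_succ]
  omega

lemma lower (m c : ℕ) (hc : HellyBound (m + 1) 2 c) : 2 * (2 ^ (m + 1) - 1) ≤ c := by
  rw [← card_WI]
  refine lower_core (AA (m := m)) BB wpt Sum.inl Sum.inl_injective wpt_lat
    wpt_sat wpt_viol (fpt m false) (fpt m true) ?_ feas (fpt_lat _ _) (fpt_lat _ _)
    (fpt_sat _) (fpt_sat _) hc
  intro h
  have := congrFun h 0
  simp [fpt, bv] at this

/-- `c(n,2) = 2(2^n − 1)`. -/
theorem stmt13 (n : ℕ) (hn : 1 ≤ n) : cnk n 2 = 2 * (2 ^ n - 1) := by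
  obtain ⟨m, rfl⟩ : ∃ m, n = m + 1 := ⟨n - 1, by omega⟩
  refine le_antisymm (Nat.sInf_le (upper _)) ?_
  exact le_csInf ⟨_, upper _⟩ (fun c hc => lower m c hc)
end
end
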